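/- arXiv:2303.17800 — 4 statements merged into one kernel-verified Lean document; each statement's English description precedes it below -/
import Mathlib

section
/- Among the 21 roots of E6 with positive coefficient at α2, exactly two are dominant for the Levi subgroup, i.e. satisfy ⟨v, αj⟩ ≥ 0 for all j ∈ {1,3,4,5,6}: namely the highest root ω2 and the root ω4 − ω2 = α1+α2+2α3+3α4+2α5+α6. (This gives the decomposition of the nilradical, hence T_X is an extension of 𝒪(1) by 𝒮^{ω4}(−1) on X = E6/P2.) -/
noncomputable section

/-- The ambient space ℚ^8. -/
abbrev V : Type := Fin 8 → ℚ

/-- The standard dot product on ℚ^8. -/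
def dot (v w : V) : ℚ := ∑ j, v j * w j

/-- The standard basis vectors ε1, …, ε8 (zero-indexed). -/
def ε (i : Fin 8) : V := fun j => if j = i then 1 else 0

/-- The simple roots α1, …, α6 of E6 in Bourbaki numbering (zero-indexed). -/
def α : Fin 6 → V :=
  ![(1/2 : ℚ) • (ε 0 + ε 7) - (1/2 : ℚ) • (ε 1 + ε 2 + ε 3 + ε 4 + ε 5 + ε 6),
    ε 0 + ε 1,
    ε 1 - ε 0,
    ε 2 - ε 1,
    ε 3 - ε 2,
    ε 4 - ε 3]

/-- The fundamental weights ω1, …, ω6 (zero-indexed). -/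
def ω : Fin 6 → V :=
  ![(1/3 : ℚ) • (4 • α 0 + 3 • α 1 + 5 • α 2 + 6 • α 3 + 4 • α 4 + 2 • α 5),
    α 0 + 2 • α 1 + 2 • α 2 + 3 • α 3 + 2 • α 4 + α 5,
    (1/3 : ℚ) • (5 • α 0 + 6 • α 1 + 10 • α 2 + 12 • α 3 + 8 • α 4 + 4 • α 5),
    2 • α 0 + 3 • α 1 + 4 • α 2 + 6 • α 3 + 4 • α 4 + 2 • α 5,
    (1/3 : ℚ) • (4 • α 0 + 6 • α 1 + 8 • α 2 + 12 • α 3 + 10 • α 4 + 5 • α 5),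
    (1/3 : ℚ) • (2 • α 0 + 3 • α 1 + 4 • α 2 + 6 • α 3 + 5 • α 4 + 4 • α 5)]

/-- The sum of the fundamental weights. -/
def ρ : V := ω 0 + ω 1 + ω 2 + ω 3 + ω 4 + ω 5

/-- The reflection in a vector `a` of squared length 2. -/
def reflect (a v : V) : V := v - dot v a • a

/-- The root system of E6: integral combinations of the simple roots of squared length 2. -/
def R : Set V := {v | (∃ c : Fin 6 → ℤ, v = ∑ i, (c i : ℚ) • α i) ∧ dot v v = 2}

/-- The roots of E6 with positive coefficient at α2. -/
def Ψ : Set V :=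
  {v ∈ R | ∃ c : Fin 6 → ℤ, v = ∑ i, (c i : ℚ) • α i ∧ 1 ≤ c 1}

/-- Coordinates of an integral combination of the simple roots. -/
lemma sum_smul_simple_roots (c : Fin 6 → ℤ) :
    (∑ i, (c i : ℚ) • α i : V) =
      ![(c 0 : ℚ) / 2 + c 1 - c 2, -(c 0 : ℚ) / 2 + c 1 + c 2 - c 3,
        -(c 0 : ℚ) / 2 + c 3 - c 4, -(c 0 : ℚ) / 2 + c 4 - c 5, -(c 0 : ℚ) / 2 + c 5,
        -(c 0 : ℚ) / 2, -(c 0 : ℚ) / 2, (c 0 : ℚ) / 2] := by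
  funext j
  fin_cases j <;> simp [Fin.sum_univ_six, α, ε] <;> ring

lemma highest_root_eq_sum :
    ω 1 = ∑ i, ((![1, 2, 2, 3, 2, 1] : Fin 6 → ℤ) i : ℚ) • α i := by
  simp [Fin.sum_univ_six, ω, ← Nat.cast_smul_eq_nsmul ℚ]

lemma weight_diff_eq_sum :
    ω 3 - ω 1 = ∑ i, ((![1, 1, 2, 3, 2, 1] : Fin 6 → ℤ) i : ℚ) • α i := by
  simp [Fin.sum_univ_six, ω, ← Nat.cast_smul_eq_nsmul ℚ]
  module

/-- The norm equation for an integral vector whose pairings with the simple roots of the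
Levi subgroup are nonnegative has only two solutions with positive coefficient at `α 1`. -/
lemma levi_dominant_coefficients {x y z w s t : ℤ} (hy : 1 ≤ y)
    (hn : x ^ 2 + y ^ 2 + z ^ 2 + w ^ 2 + s ^ 2 + t ^ 2
      - x * z - z * w - y * w - w * s - s * t = 1)
    (h0 : 0 ≤ 2 * x - z) (h2 : 0 ≤ 2 * z - x - w) (h3 : 0 ≤ 2 * w - z - y - s)
    (h4 : 0 ≤ 2 * s - w - t) (h5 : 0 ≤ 2 * t - s) :
    (x = 1 ∧ y = 2 ∧ z = 2 ∧ w = 3 ∧ s = 2 ∧ t = 1) ∨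
      (x = 1 ∧ y = 1 ∧ z = 2 ∧ w = 3 ∧ s = 2 ∧ t = 1) := by
  obtain ⟨a, ha⟩ : ∃ a, a = 2 * x - z := ⟨_, rfl⟩
  obtain ⟨b, hb⟩ : ∃ b, b = 2 * z - x - w := ⟨_, rfl⟩
  obtain ⟨c, hc⟩ : ∃ c, c = 2 * w - z - y - s := ⟨_, rfl⟩
  obtain ⟨d, hd⟩ : ∃ d, d = 2 * s - w - t := ⟨_, rfl⟩
  obtain ⟨e, he⟩ : ∃ e, e = 2 * t - s := ⟨_, rfl⟩
  rw [← ha] at h0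
  rw [← hb] at h2
  rw [← hc] at h3
  rw [← hd] at h4
  rw [← he] at h5
  have key : 3 * y ^ 2 + (5 * a ^ 2 + 8 * b ^ 2 + 9 * c ^ 2 + 8 * d ^ 2 + 5 * e ^ 2)
      + 2 * (4 * (a * b) + 3 * (a * c) + 2 * (a * d) + a * e + 6 * (b * c) + 4 * (b * d)
        + 2 * (b * e) + 6 * (c * d) + 3 * (c * e) + 4 * (d * e)) = 12 := by
    subst ha hb hc hd he
    linear_combination 12 * hn
  have hab := mul_nonneg h0 h2
  have hac := mul_nonneg h0 h3
  have had := mul_nonneg h0 h4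
  have hae := mul_nonneg h0 h5
  have hbc := mul_nonneg h2 h3
  have hbd := mul_nonneg h2 h4
  have hbe := mul_nonneg h2 h5
  have hcd := mul_nonneg h3 h4
  have hce := mul_nonneg h3 h5
  have hde := mul_nonneg h4 h5
  have sqa := sq_nonneg a
  have sqb := sq_nonneg b
  have sqc := sq_nonneg c
  have sqd := sq_nonneg d
  have sqe := sq_nonneg e
  have sqy : 1 ≤ y ^ 2 := by nlinarith
  have y2 : y ≤ 2 := by
    have : y ^ 2 ≤ 4 := by linarith
    nlinarith
  have le_one : ∀ k : ℤ, 5 * k ^ 2 ≤ 9 → k ≤ 1 := fun k hk => by nlinarith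
  have a1 : a ≤ 1 := le_one a (by linarith)
  have b1 : b ≤ 1 := le_one b (by linarith)
  have c1 : c ≤ 1 := le_one c (by linarith)
  have d1 : d ≤ 1 := le_one d (by linarith)
  have e1 : e ≤ 1 := le_one e (by linarith)
  clear hn hab hac had hae hbc hbd hbe hcd hce hde sqa sqb sqc sqd sqe sqy le_one
  interval_cases y <;> interval_cases a <;> interval_cases b <;> interval_cases c <;>
    interval_cases d <;> interval_cases e <;> omega

/-- Among the 21 roots with positive coefficient at α2, exactly two are dominant for the
Levi (pair non-negatively with αj for j ∈ {1,3,4,5,6}): the highest root ω2 and ω4 − ω2. -/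
theorem stmt_10 :
    {v ∈ Ψ | ∀ j ∈ ({0, 2, 3, 4, 5} : Set (Fin 6)), 0 ≤ dot v (α j)}
      = {ω 1, ω 3 - ω 1} ∧
    (ω 1 : V) ≠ ω 3 - ω 1 ∧
    ω 3 - ω 1 = α 0 + α 1 + 2 • α 2 + 3 • α 3 + 2 • α 4 + α 5 := by
  refine ⟨?_, ?_, ?_⟩
  · ext v
    simp only [Set.mem_ofPred_eq, Set.mem_insert_iff, Set.mem_singleton_iff]
    constructor
    · rintro ⟨⟨⟨-, hv⟩, c, rfl, hc⟩, h⟩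
      have h0 := h 0 (by simp)
      have h2 := h 2 (by simp)
      have h3 := h 3 (by simp)
      have h4 := h 4 (by simp)
      have h5 := h 5 (by simp)
      rw [sum_smul_simple_roots] at hv h0 h2 h3 h4 h5
      simp [dot, Fin.sum_univ_eight, α, ε] at hv h0 h2 h3 h4 h5
      have := levi_dominant_coefficients (x := c 0) (y := c 1) (z := c 2) (w := c 3)
        (s := c 4) (t := c 5) hc
        (by qify; linear_combination hv / 2)
        (by qify; linarith) (by qify; linarith) (by qify; linarith)
        (by qify; linarith) (by qify; linarith)
      rcases this with ⟨e0, e1, e2, e3, e4, e5⟩ | ⟨e0, e1, e2, e3, e4, e5⟩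
      · left
        rw [highest_root_eq_sum]
        simp [Fin.sum_univ_six, e0, e1, e2, e3, e4, e5]
      · right
        rw [weight_diff_eq_sum]
        simp [Fin.sum_univ_six, e0, e1, e2, e3, e4, e5]
    · rintro (rfl | rfl)
      · refine ⟨⟨⟨⟨_, highest_root_eq_sum⟩, ?_⟩, _, highest_root_eq_sum, by simp⟩, ?_⟩
        · rw [highest_root_eq_sum, sum_smul_simple_roots]
          simp [dot, Fin.sum_univ_eight]
          norm_num
        · rw [highest_root_eq_sum, sum_smul_simple_roots]
          rintro j (rfl | rfl | rfl | rfl | rfl) <;>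
            simp [dot, Fin.sum_univ_eight, α, ε] <;> norm_num
      · refine ⟨⟨⟨⟨_, weight_diff_eq_sum⟩, ?_⟩, _, weight_diff_eq_sum, by simp⟩, ?_⟩
        · rw [weight_diff_eq_sum, sum_smul_simple_roots]
          simp [dot, Fin.sum_univ_eight]
          norm_num
        · rw [weight_diff_eq_sum, sum_smul_simple_roots]
          rintro j (rfl | rfl | rfl | rfl | rfl) <;>
            simp [dot, Fin.sum_univ_eight, α, ε] <;> norm_num
  · intro h
    rw [weight_diff_eq_sum, highest_root_eq_sum, sum_smul_simple_roots,
      sum_smul_simple_roots] at h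
    have := congrFun h 0
    simp at this
    norm_num at this
  · simp only [ω, Matrix.cons_val]
    module
end
end

section
/- There exists an element w of the subgroup W_L of linear automorphisms of ℚ^8 generated by the reflections r_{α1}, r_{α3}, r_{α4}, r_{α5}, r_{α6} (namely the longest element of the Weyl group of the Levi of type A5) satisfying simultaneously: w(ω1) = ω2 − ω6, w(ω6) = ω2 − ω1, w(ω3) = 2ω2 − ω5, w(ω5) = 2ω2 − ω3, w(ω4) = 3ω2 − ω4, and w(ω2) = ω2. (This computes the duals of equivariant bundles, e.g. (𝒮^{ω1})^∨ ≅ 𝒮^{ω6}(−1) on E6/P2.) -/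
noncomputable section

/-- The full Weyl group: the subgroup of linear automorphisms of ℚ^8 generated by the
six simple reflections r_{α1}, …, r_{α6}. -/
def W : Subgroup (V ≃ₗ[ℚ] V) :=
  Subgroup.closure {g | ∃ i : Fin 6, ∀ v, g v = reflect (α i) v}

/-- The Weyl group of the Levi: generated by r_{α1}, r_{α3}, r_{α4}, r_{α5}, r_{α6}. -/
def WL : Subgroup (V ≃ₗ[ℚ] V) :=
  Subgroup.closure {g | ∃ i : Fin 6, i ≠ 1 ∧ ∀ v, g v = reflect (α i) v}

/-- Pairing with a fixed vector, as a linear form. -/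
def dotForm (a : V) : V →ₗ[ℚ] ℚ where
  toFun v := dot v a
  map_add' u v := add_dotProduct u v a
  map_smul' c v := smul_dotProduct c v a

theorem dotForm_root_self (i : Fin 6) : dotForm (α i) (α i) = 2 := by
  change dot (α i) (α i) = 2
  revert i
  decide +kernel

/-- The simple reflection `r_{αi}` as a linear automorphism. -/
def simpleReflection (i : Fin 6) : V ≃ₗ[ℚ] V :=
  Module.reflection (dotForm_root_self i)

theorem simpleReflection_apply (i : Fin 6) (v : V) :
    simpleReflection i v = reflect (α i) v := rfl

theorem simpleReflection_mem_WL {i : Fin 6} (hi : i ≠ 1) : simpleReflection i ∈ WL :=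
  Subgroup.subset_closure ⟨i, hi, simpleReflection_apply i⟩

/-- Fundamental weights are dual to simple roots. -/
theorem dot_weight_root (i j : Fin 6) : dot (ω i) (α j) = if i = j then 1 else 0 := by
  revert i j
  decide +kernel

/-- The integral weight with given coordinates in the basis of fundamental weights. -/
def integralWeight (c : Fin 6 → ℤ) : V := ∑ j, (c j : ℚ) • ω j

/-- The rows of the Cartan matrix express the simple roots in the fundamental weights. -/
theorem root_eq_integralWeight (i : Fin 6) : α i = integralWeight (CartanMatrix.E₆ i) := by
  revert i
  decide +kernel

theorem integralWeight_sub_smul (b c : Fin 6 → ℤ) (n : ℤ) :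
    integralWeight (c - n • b) = integralWeight c - (n : ℚ) • integralWeight b := by
  simp [integralWeight, sub_smul, mul_smul, Finset.smul_sum, Finset.sum_sub_distrib]

theorem dot_integralWeight_root (c : Fin 6 → ℤ) (i : Fin 6) :
    dot (integralWeight c) (α i) = c i := by
  change dotForm (α i) (∑ j, (c j : ℚ) • ω j) = c i
  have h (j : Fin 6) : dotForm (α i) (ω j) = if j = i then 1 else 0 := dot_weight_root j i
  simp [h]

theorem simpleReflection_integralWeight (i : Fin 6) (c : Fin 6 → ℤ) :
    simpleReflection i (integralWeight c) = integralWeight (c - c i • CartanMatrix.E₆ i) := by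
  rw [simpleReflection_apply, reflect, dot_integralWeight_root, integralWeight_sub_smul,
    ← root_eq_integralWeight]

theorem prod_simpleReflection_integralWeight (l : List (Fin 6)) (c : Fin 6 → ℤ) :
    (l.map simpleReflection).prod (integralWeight c) =
      integralWeight (l.foldr (fun i b => b - b i • CartanMatrix.E₆ i) c) := by
  induction l with
  | nil => rfl
  | cons i l ih =>
    rw [List.map_cons, List.prod_cons, LinearEquiv.mul_apply, ih,
      simpleReflection_integralWeight, List.foldr_cons]

/-- A reduced word for the longest element of the Levi Weyl group of type A5. -/
def longestWord : List (Fin 6) := [0, 2, 0, 3, 2, 0, 4, 3, 2, 0, 5, 4, 3, 2, 0]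

theorem longestWord_prod_weight {v v' : V} (c c' : Fin 6 → ℤ) (hv : v = integralWeight c)
    (hv' : v' = integralWeight c')
    (h : longestWord.foldr (fun i b => b - b i • CartanMatrix.E₆ i) c = c') :
    (longestWord.map simpleReflection).prod v = v' := by
  rw [hv, hv', prod_simpleReflection_integralWeight, h]

/-- There is an element of the Levi Weyl group (its longest element) acting on the
fundamental weights by ω1 ↦ ω2 − ω6, ω6 ↦ ω2 − ω1, ω3 ↦ 2ω2 − ω5, ω5 ↦ 2ω2 − ω3,
ω4 ↦ 3ω2 − ω4, ω2 ↦ ω2. -/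
theorem stmt_13 :
    ∃ w ∈ WL,
      w (ω 0) = ω 1 - ω 5 ∧
      w (ω 5) = ω 1 - ω 0 ∧
      w (ω 2) = 2 • ω 1 - ω 4 ∧
      w (ω 4) = 2 • ω 1 - ω 2 ∧
      w (ω 3) = 3 • ω 1 - ω 3 ∧
      w (ω 1) = ω 1 := by
  refine ⟨(longestWord.map simpleReflection).prod, ?_, ?_, ?_, ?_, ?_, ?_, ?_⟩
  · refine list_prod_mem fun g hg => ?_
    obtain ⟨i, hi, rfl⟩ := List.mem_map.mp hg
    exact simpleReflection_mem_WL (by rintro rfl; revert hi; decide)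
  · refine longestWord_prod_weight ![1, 0, 0, 0, 0, 0] ![0, 1, 0, 0, 0, -1] ?_ ?_ ?_ <;>
      decide +kernel
  · refine longestWord_prod_weight ![0, 0, 0, 0, 0, 1] ![-1, 1, 0, 0, 0, 0] ?_ ?_ ?_ <;>
      decide +kernel
  · refine longestWord_prod_weight ![0, 0, 1, 0, 0, 0] ![0, 2, 0, 0, -1, 0] ?_ ?_ ?_ <;>
      decide +kernel
  · refine longestWord_prod_weight ![0, 0, 0, 0, 1, 0] ![0, 2, -1, 0, 0, 0] ?_ ?_ ?_ <;>
      decide +kernel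
  · refine longestWord_prod_weight ![0, 0, 0, 1, 0, 0] ![0, 3, 0, -1, 0, 0] ?_ ?_ ?_ <;>
      decide +kernel
  · refine longestWord_prod_weight ![0, 1, 0, 0, 0, 0] ![0, 1, 0, 0, 0, 0] ?_ ?_ ?_ <;>
      decide +kernel
end
end

section
/- For every integer i with 1 ≤ i ≤ 10, the weight ρ − i·ω2 is singular, i.e. there exists a root β ∈ R with ⟨ρ − i·ω2, β⟩ = 0. (By Borel–Weil–Bott this shows the line bundles 𝒪(−i) on E6/P2 are acyclic for 1 ≤ i ≤ 10.) -/
noncomputable section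

theorem sum_smul_α (c : Fin 6 → ℚ) :
    ∑ k, c k • α k =
      ![c 0 / 2 + c 1 - c 2, -c 0 / 2 + c 1 + c 2 - c 3, -c 0 / 2 + c 3 - c 4,
        -c 0 / 2 + c 4 - c 5, -c 0 / 2 + c 5, -c 0 / 2, -c 0 / 2, c 0 / 2] := by
  ext j
  fin_cases j <;> simp [Fin.sum_univ_succ, α, ε] <;> ring

theorem ω_one_eq : ω 1 = ![1/2, 1/2, 1/2, 1/2, 1/2, -1/2, -1/2, 1/2] := by
  ext j
  fin_cases j <;> simp [ω, α, ε] <;> norm_num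

theorem ρ_eq : ρ = ![0, 1, 2, 3, 4, -4, -4, 4] := by
  ext j
  fin_cases j <;> simp [ρ, ω, α, ε] <;> norm_num

/-- The weight `ρ - i • ω 1` pairs with a vector of the root lattice to its height minus `i` times
its coefficient at `α 1`. -/
theorem dot_ρ_sub_smul_ω_one (i : ℤ) (c : Fin 6 → ℚ) :
    dot (ρ - i • ω 1) (∑ k, c k • α k) = ∑ k, c k - i * c 1 := by
  rw [sum_smul_α, ρ_eq, ω_one_eq]
  simp [dot, Fin.sum_univ_succ]
  ring

/-- The quadratic form of E6 in the basis of simple roots. -/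
theorem dot_self_sum_smul_α (c : Fin 6 → ℚ) :
    dot (∑ k, c k • α k) (∑ k, c k • α k) =
      2 * (∑ k, c k ^ 2 - c 0 * c 2 - c 1 * c 3 - c 2 * c 3 - c 3 * c 4 - c 4 * c 5) := by
  rw [sum_smul_α]
  simp [dot, Fin.sum_univ_succ]
  ring

/-- A root of height `i` with coefficient 1 at `α 1` makes `ρ - i • ω 1` singular. -/
theorem exists_root_orthogonal (i : ℤ) (c : Fin 6 → ℤ) (hc : c 1 = 1) (hi : ∑ k, c k = i)
    (hq : ∑ k, c k ^ 2 - c 0 * c 2 - c 1 * c 3 - c 2 * c 3 - c 3 * c 4 - c 4 * c 5 = 1) :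
    ∃ β ∈ R, dot (ρ - i • ω 1) β = 0 := by
  refine ⟨∑ k, (c k : ℚ) • α k, ⟨⟨c, rfl⟩, ?_⟩, ?_⟩
  · rw [dot_self_sum_smul_α]
    have hq' : ((∑ k, c k ^ 2 - c 0 * c 2 - c 1 * c 3 - c 2 * c 3 - c 3 * c 4 - c 4 * c 5 : ℤ) : ℚ)
        = 1 := by exact_mod_cast hq
    push_cast at hq'
    rw [hq', mul_one]
  · rw [dot_ρ_sub_smul_ω_one, hc, ← hi]
    push_cast
    ring

/-- For 1 ≤ i ≤ 10, the weight ρ − iω2 is singular. -/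
theorem stmt_14 :
    ∀ i : ℤ, 1 ≤ i → i ≤ 10 → ∃ β ∈ R, dot (ρ - i • ω 1) β = 0 := by
  intro i h1 h10
  interval_cases i
  · exact exists_root_orthogonal 1 ![0, 1, 0, 0, 0, 0] rfl (by decide) (by decide)
  · exact exists_root_orthogonal 2 ![0, 1, 0, 1, 0, 0] rfl (by decide) (by decide)
  · exact exists_root_orthogonal 3 ![0, 1, 1, 1, 0, 0] rfl (by decide) (by decide)
  · exact exists_root_orthogonal 4 ![1, 1, 1, 1, 0, 0] rfl (by decide) (by decide)
  · exact exists_root_orthogonal 5 ![1, 1, 1, 1, 1, 0] rfl (by decide) (by decide)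
  · exact exists_root_orthogonal 6 ![1, 1, 1, 1, 1, 1] rfl (by decide) (by decide)
  · exact exists_root_orthogonal 7 ![1, 1, 1, 2, 1, 1] rfl (by decide) (by decide)
  · exact exists_root_orthogonal 8 ![1, 1, 2, 2, 1, 1] rfl (by decide) (by decide)
  · exact exists_root_orthogonal 9 ![1, 1, 2, 2, 2, 1] rfl (by decide) (by decide)
  · exact exists_root_orthogonal 10 ![1, 1, 2, 3, 2, 1] rfl (by decide) (by decide)
end
end

section
/- For all integers i, b with 1 ≤ i ≤ 10 and 1 ≤ b ≤ 6, both weights ω1 + b·ω6 − (i+b)·ω2 + ρ and b·ω1 + ω6 − (i+b)·ω2 + ρ are singular, i.e. each is orthogonal to some root β ∈ R. (By Borel–Weil–Bott this shows the bundles 𝒮^{ω1+bω6}(−i−b) and 𝒮^{bω1+ω6}(−i−b) on E6/P2 are acyclic in this range.) -/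
noncomputable section

/-- Half of the E6 quadratic form in simple-root coordinates. -/
def rootForm (a b c d e f : ℤ) : ℤ :=
  a ^ 2 + b ^ 2 + c ^ 2 + d ^ 2 + e ^ 2 + f ^ 2 - a * c - c * d - b * d - d * e - e * f

/-- An integral combination of the simple roots. -/
def rootCombination (a b c d e f : ℤ) : V := ∑ j, ((![a, b, c, d, e, f] j : ℤ) : ℚ) • α j

lemma rootCombination_mem_R {a b c d e f : ℤ} (h : rootForm a b c d e f = 1) :
    rootCombination a b c d e f ∈ R := by
  refine ⟨⟨_, rfl⟩, ?_⟩
  have h' : (rootForm a b c d e f : ℚ) = 1 := by exact_mod_cast h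
  simp only [rootForm] at h'
  push_cast at h'
  simp [rootCombination, dot, α, ε, Fin.sum_univ_succ]
  linear_combination 2 * h'

lemma dot_weight_rootCombination (p q r : ℤ) (a b c d e f : ℤ) :
    dot (p • ω 0 + q • ω 5 - r • ω 1 + ρ) (rootCombination a b c d e f) =
      (((p + 1) * a + (1 - r) * b + c + d + e + (q + 1) * f : ℤ) : ℚ) := by
  simp [rootCombination, dot, ρ, ω, α, ε, Fin.sum_univ_succ]
  ring

lemma exists_rootForm_eq_one (i b : ℤ) (hi : 1 ≤ i) (hi' : i ≤ 10) (hb : 1 ≤ b) (hb' : b ≤ 6) :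
    ∃ c₁ c₂ c₃ c₄ c₅ c₆ : ℤ, rootForm c₁ c₂ c₃ c₄ c₅ c₆ = 1 ∧
      2 * c₁ + (1 - (i + b)) * c₂ + c₃ + c₄ + c₅ + (b + 1) * c₆ = 0 := by
  by_cases h : i ≤ 3
  · obtain ⟨s, hs⟩ : ∃ s, s = i + b := ⟨_, rfl⟩
    have hs₂ : 2 ≤ s := by lia
    have hs₉ : s ≤ 9 := by lia
    rw [← hs]
    interval_cases s
    · exact ⟨0, 1, 0, 1, 0, 0, by decide, by ring⟩
    · exact ⟨0, 1, 1, 1, 0, 0, by decide, by ring⟩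
    · exact ⟨0, 1, 1, 1, 1, 0, by decide, by ring⟩
    · exact ⟨1, 1, 1, 1, 0, 0, by decide, by ring⟩
    · exact ⟨1, 1, 1, 1, 1, 0, by decide, by ring⟩
    · exact ⟨1, 1, 1, 2, 1, 0, by decide, by ring⟩
    · exact ⟨1, 1, 2, 2, 1, 0, by decide, by ring⟩
    · exact ⟨1, 2, 2, 3, 2, 1, by decide, by lia⟩
  · have hi₄ : 4 ≤ i := by lia
    interval_cases i
    · exact ⟨0, 1, 0, 1, 1, 1, by decide, by ring⟩
    · exact ⟨0, 1, 1, 1, 1, 1, by decide, by ring⟩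
    · exact ⟨0, 1, 1, 2, 1, 1, by decide, by ring⟩
    · exact ⟨1, 1, 1, 1, 1, 1, by decide, by ring⟩
    · exact ⟨1, 1, 1, 2, 1, 1, by decide, by ring⟩
    · exact ⟨1, 1, 2, 2, 1, 1, by decide, by ring⟩
    · exact ⟨1, 1, 2, 2, 2, 1, by decide, by ring⟩

/-- For 1 ≤ i ≤ 10 and 1 ≤ b ≤ 6, the weights ω1 + bω6 − (i+b)ω2 + ρ and
bω1 + ω6 − (i+b)ω2 + ρ are singular. -/
theorem stmt_16 :
    ∀ i b : ℤ, 1 ≤ i → i ≤ 10 → 1 ≤ b → b ≤ 6 →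
      (∃ β ∈ R, dot (ω 0 + b • ω 5 - (i + b) • ω 1 + ρ) β = 0) ∧
      (∃ β ∈ R, dot (b • ω 0 + ω 5 - (i + b) • ω 1 + ρ) β = 0) := by
  intro i b hi hi' hb hb'
  obtain ⟨c₁, c₂, c₃, c₄, c₅, c₆, hform, hzero⟩ := exists_rootForm_eq_one i b hi hi' hb hb'
  constructor
  · refine ⟨rootCombination c₁ c₂ c₃ c₄ c₅ c₆, rootCombination_mem_R hform, ?_⟩
    have h := dot_weight_rootCombination 1 b (i + b) c₁ c₂ c₃ c₄ c₅ c₆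
    rw [one_smul] at h
    rw [h]
    exact_mod_cast (by linear_combination hzero)
  · refine ⟨rootCombination c₆ c₂ c₅ c₄ c₃ c₁, rootCombination_mem_R ?_, ?_⟩
    · rw [← hform, rootForm, rootForm]
      ring
    · have h := dot_weight_rootCombination b 1 (i + b) c₆ c₂ c₅ c₄ c₃ c₁
      rw [one_smul] at h
      rw [h]
      exact_mod_cast (by linear_combination hzero)
end
end
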